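/- arXiv:1902.11152 — 6 statements merged into one kernel-verified Lean document; each statement's English description precedes it below -/
import Mathlib

section
/- Let κ_f > 0, κ_b > 0 and A₀, B₀ > 0. Define c₁ = A₀ − B₀, c₂ = √(κ_f²c₁² + 4κ_f κ_b), c₃ = A₀ + B₀, c₄ = (c₂ − κ_f c₃)/(c₂ + κ_f c₃), and for t ≥ 0 set C_A(t) = (c₂ + κ_f c₁ − (c₂ − κ_f c₁)·c₄·e^{−c₂ t}) / (2κ_f·(1 + c₄·e^{−c₂ t})) and C_B(t) = (c₂ − κ_f c₁ − (c₂ + κ_f c₁)·c₄·e^{−c₂ t}) / (2κ_f·(1 + c₄·e^{−c₂ t})). Then C_A(0) = A₀, C_B(0) = B₀, and for every t ≥ 0 the derivatives satisfy C_A′(t) = κ_b − κ_f·C_A(t)·C_B(t) and C_B′(t) = κ_b − κ_f·C_A(t)·C_B(t). -/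
theorem aux_deriv (k s d c t b : ℝ) (hk : 0 < k)
    (hb : b = (s ^ 2 - k ^ 2 * d ^ 2) / (4 * k))
    (hD : 1 + c * Real.exp (-s * t) ≠ 0) :
    HasDerivAt (fun t => (s + k * d - (s - k * d) * c * Real.exp (-s * t)) /
        (2 * k * (1 + c * Real.exp (-s * t))))
      (b - k * ((s + k * d - (s - k * d) * c * Real.exp (-s * t)) /
        (2 * k * (1 + c * Real.exp (-s * t)))) *
        ((s - k * d - (s + k * d) * c * Real.exp (-s * t)) /
        (2 * k * (1 + c * Real.exp (-s * t))))) t := by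
  have he : HasDerivAt (fun t => Real.exp (-s * t)) (Real.exp (-s * t) * (-s)) t := by
    have h := ((hasDerivAt_id t).const_mul (-s)).exp
    simpa using h
  have h1 := (he.const_mul ((s - k * d) * c)).const_sub (s + k * d)
  have h2 := ((he.const_mul c).const_add 1).const_mul (2 * k)
  have h3 := h1.div h2 (mul_ne_zero (by positivity) hD)
  refine h3.congr_deriv ?_
  subst hb
  generalize Real.exp (-s * t) = e at *
  field_simp
  ring

theorem stmt_3 (κf κb A₀ B₀ : ℝ) (hκf : 0 < κf) (hκb : 0 < κb)
    (hA : 0 < A₀) (hB : 0 < B₀) :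
    let c₁ := A₀ - B₀
    let c₂ := Real.sqrt (κf ^ 2 * c₁ ^ 2 + 4 * κf * κb)
    let c₃ := A₀ + B₀
    let c₄ := (c₂ - κf * c₃) / (c₂ + κf * c₃)
    let CA : ℝ → ℝ := fun t =>
      (c₂ + κf * c₁ - (c₂ - κf * c₁) * c₄ * Real.exp (-c₂ * t)) /
        (2 * κf * (1 + c₄ * Real.exp (-c₂ * t)))
    let CB : ℝ → ℝ := fun t =>
      (c₂ - κf * c₁ - (c₂ + κf * c₁) * c₄ * Real.exp (-c₂ * t)) /
        (2 * κf * (1 + c₄ * Real.exp (-c₂ * t)))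
    CA 0 = A₀ ∧ CB 0 = B₀ ∧
      ∀ t : ℝ, 0 ≤ t →
        HasDerivAt CA (κb - κf * CA t * CB t) t ∧
        HasDerivAt CB (κb - κf * CA t * CB t) t := by
  intro c₁ c₂ c₃ c₄ CA CB
  have hpos : 0 < κf ^ 2 * c₁ ^ 2 + 4 * κf * κb := by positivity
  have hs : 0 < c₂ := Real.sqrt_pos.mpr hpos
  have hsq : c₂ ^ 2 = κf ^ 2 * c₁ ^ 2 + 4 * κf * κb := Real.sq_sqrt hpos.le
  have hc3 : 0 < κf * c₃ := mul_pos hκf (add_pos hA hB)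
  have hden : 0 < c₂ + κf * c₃ := by linarith
  have hc4 : -1 < c₄ := by
    show -1 < (c₂ - κf * c₃) / (c₂ + κf * c₃)
    rw [lt_div_iff₀ hden]
    linarith
  have hb : κb = (c₂ ^ 2 - κf ^ 2 * c₁ ^ 2) / (4 * κf) := by
    rw [hsq]
    field_simp
    ring
  have hp : c₄ * (c₂ + κf * c₃) = c₂ - κf * c₃ := div_mul_cancel₀ _ hden.ne'
  have h14 : 0 < 1 + c₄ := by linarith
  have e1 : c₁ = A₀ - B₀ := rfl
  have e3 : c₃ = A₀ + B₀ := rfl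
  refine ⟨?_, ?_, ?_⟩
  · show (c₂ + κf * c₁ - (c₂ - κf * c₁) * c₄ * Real.exp (-c₂ * 0)) /
        (2 * κf * (1 + c₄ * Real.exp (-c₂ * 0))) = A₀
    rw [mul_zero, Real.exp_zero, mul_one, mul_one, div_eq_iff (by positivity)]
    rw [e3] at hp
    rw [e1]
    linear_combination -hp
  · show (c₂ - κf * c₁ - (c₂ + κf * c₁) * c₄ * Real.exp (-c₂ * 0)) /
        (2 * κf * (1 + c₄ * Real.exp (-c₂ * 0))) = B₀
    rw [mul_zero, Real.exp_zero, mul_one, mul_one, div_eq_iff (by positivity)]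
    rw [e3] at hp
    rw [e1]
    linear_combination -hp
  · intro t ht
    have he0 : 0 < Real.exp (-c₂ * t) := Real.exp_pos _
    have he1 : Real.exp (-c₂ * t) ≤ 1 := Real.exp_le_one_iff.mpr (by nlinarith)
    have hD : 1 + c₄ * Real.exp (-c₂ * t) ≠ 0 := by
      have := mul_pos h14 he0
      nlinarith
    refine ⟨aux_deriv κf c₂ c₁ c₄ t κb hκf hb hD, ?_⟩
    have h := aux_deriv κf c₂ (-c₁) c₄ t κb hκf (by rw [neg_sq]; exact hb) hD
    simp only [mul_neg, sub_neg_eq_add, ← sub_eq_add_neg] at h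
    refine h.congr_deriv ?_
    show _ = κb - κf * ((c₂ + κf * c₁ - (c₂ - κf * c₁) * c₄ * Real.exp (-c₂ * t)) /
        (2 * κf * (1 + c₄ * Real.exp (-c₂ * t)))) *
        ((c₂ - κf * c₁ - (c₂ + κf * c₁) * c₄ * Real.exp (-c₂ * t)) /
        (2 * κf * (1 + c₄ * Real.exp (-c₂ * t))))
    ring
end

section
/- Let n ≥ 1, D > 0, and let f : ℝⁿ → ℝ (Euclidean space) be bounded and continuous. For x ∈ ℝⁿ and t > 0 define u(x,t) = (4πDt)^{−n/2} · ∫_{ℝⁿ} f(y)·exp(−‖x − y‖²/(4Dt)) dy. Then for every x ∈ ℝⁿ and t > 0, the time derivative of u equals D times the Laplacian of u in the space variable: ∂u/∂t(x,t) = D·Δu(x,t), where Δu(x,t) = Σᵢ ∂²u/∂xᵢ²(x,t) is the sum of the second partial derivatives of u(·,t) along an orthonormal basis of ℝⁿ. -/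
open MeasureTheory Filter Topology

/-- Polynomial times Gaussian is dominated by a wider Gaussian. -/
lemma heat_bnd (a : ℝ) (ha : 0 < a) (s : ℝ) (hs : 0 ≤ s) :
    (1 + s) * Real.exp (-s / a) ≤ (1 + 2 * a) * Real.exp (-(1 / (2 * a)) * s) := by
  have h1 : s / (2 * a) + 1 ≤ Real.exp (s / (2 * a)) := Real.add_one_le_exp _
  have h0 : 0 ≤ s / (2 * a) := by positivity
  have h2 : s = 2 * a * (s / (2 * a)) := by field_simp
  have h3 : 1 + s ≤ (1 + 2 * a) * Real.exp (s / (2 * a)) := by nlinarith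
  have h4 : Real.exp (-(1 / (2 * a)) * s)
      = Real.exp (s / (2 * a)) * Real.exp (-s / a) := by
    rw [← Real.exp_add]; congr 1; field_simp; ring
  rw [h4, ← mul_assoc]
  exact mul_le_mul_of_nonneg_right h3 (Real.exp_pos _).le

lemma heat_gauss_int {n : ℕ} (b : ℝ) (hb : 0 < b) (x : EuclideanSpace ℝ (Fin n)) :
    Integrable (fun y : EuclideanSpace ℝ (Fin n) => Real.exp (-b * ‖x - y‖ ^ 2)) := by
  have h := GaussianFourier.integrable_cexp_neg_mul_sq_norm_add
    (V := EuclideanSpace ℝ (Fin n)) (b := (b : ℂ)) (by simpa using hb) 0 0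
  have h2 : Integrable (fun y : EuclideanSpace ℝ (Fin n) => Real.exp (-b * ‖y‖ ^ 2)) := by
    refine h.norm.congr (Eventually.of_forall fun y => ?_)
    simp only [Complex.norm_exp]
    congr 1
    simp [← Complex.ofReal_pow]
  exact h2.comp_sub_left x

lemma heat_fderiv {n : ℕ} (f : EuclideanSpace ℝ (Fin n) → ℝ) (hf : Continuous f)
    (M : ℝ) (hM : ∀ y, |f y| ≤ M)
    (g : EuclideanSpace ℝ (Fin n) → ℝ)
    (g' : EuclideanSpace ℝ (Fin n) → (EuclideanSpace ℝ (Fin n) →L[ℝ] ℝ))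
    (hg : ∀ v, HasFDerivAt g (g' v) v) (hg' : Continuous g') (K b : ℝ) (hb : 0 < b)
    (h0 : ∀ v, |g v| ≤ K * Real.exp (-b * ‖v‖ ^ 2))
    (h1 : ∀ v, ‖g' v‖ ≤ K * Real.exp (-b * ‖v‖ ^ 2)) (x : EuclideanSpace ℝ (Fin n)) :
    Integrable (fun y => f y • g' (x - y)) ∧
    HasFDerivAt (fun w => ∫ y, f y * g (w - y)) (∫ y, f y • g' (x - y)) x := by
  have hgc : Continuous g := continuous_iff_continuousAt.2 fun v => (hg v).continuousAt
  have hM0 : 0 ≤ M := (abs_nonneg _).trans (hM 0)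
  have hK0 : 0 ≤ K := by
    have := (abs_nonneg _).trans (h0 0)
    simpa using this
  have hI' : Integrable (fun y => f y • g' (x - y)) := by
    refine ((heat_gauss_int b hb x).const_mul (M * K)).mono'
      (Continuous.aestronglyMeasurable (by fun_prop)) (Eventually.of_forall fun y => ?_)
    rw [norm_smul, Real.norm_eq_abs, mul_assoc]
    exact mul_le_mul (hM y) (h1 _) (norm_nonneg _) hM0
  refine ⟨hI', ?_⟩
  refine hasFDerivAt_integral_of_dominated_of_fderiv_le
    (F := fun w y => f y * g (w - y)) (F' := fun w y => f y • g' (w - y))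
    (bound := fun y => M * (K * Real.exp b) * Real.exp (-(b / 2) * ‖x - y‖ ^ 2))
    (Metric.ball_mem_nhds x one_pos) ?_ ?_ ?_ ?_ ?_ ?_
  · exact Eventually.of_forall fun w => Continuous.aestronglyMeasurable (by fun_prop)
  · refine ((heat_gauss_int b hb x).const_mul (M * K)).mono'
      (Continuous.aestronglyMeasurable (by fun_prop)) (Eventually.of_forall fun y => ?_)
    rw [norm_mul, Real.norm_eq_abs, Real.norm_eq_abs, mul_assoc]
    exact mul_le_mul (hM y) (h0 _) (abs_nonneg _) hM0
  · exact hI'.aestronglyMeasurable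
  · refine Eventually.of_forall fun y w hw => ?_
    rw [norm_smul, Real.norm_eq_abs, mul_assoc]
    refine mul_le_mul (hM y) ((h1 _).trans ?_) (norm_nonneg _) hM0
    rw [mul_assoc, ← Real.exp_add]
    refine mul_le_mul_of_nonneg_left (Real.exp_le_exp.2 ?_) hK0
    have hw1 : ‖x - w‖ ≤ 1 := by
      rw [← dist_eq_norm, dist_comm]; exact (Metric.mem_ball.1 hw).le
    have htri : ‖x - y‖ ≤ ‖x - w‖ + ‖w - y‖ := norm_sub_le_norm_sub_add_norm_sub x w y
    have hn1 := norm_nonneg (x - y)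
    have hn2 := norm_nonneg (w - y)
    have : ‖x - y‖ ^ 2 ≤ 2 * ‖w - y‖ ^ 2 + 2 := by
      nlinarith [sq_nonneg (‖w - y‖ - 1)]
    nlinarith
  · exact (heat_gauss_int (b / 2) (by positivity) x).const_mul _
  · refine Eventually.of_forall fun y w _ => ?_
    have := ((hg (w - y)).comp w ((hasFDerivAt_id w).sub_const y)).const_mul (f y)
    simpa using this

lemma heat_g1 {n : ℕ} (a : ℝ) (v : EuclideanSpace ℝ (Fin n)) :
    HasFDerivAt (fun v : EuclideanSpace ℝ (Fin n) => Real.exp (-‖v‖ ^ 2 / a))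
      ((Real.exp (-‖v‖ ^ 2 / a) * (-2 / a)) • innerSL ℝ v) v := by
  have h := (((hasStrictFDerivAt_norm_sq v).hasFDerivAt).const_mul (-1 / a)).exp
  have he : ∀ v : EuclideanSpace ℝ (Fin n), -‖v‖ ^ 2 / a = -1 / a * ‖v‖ ^ 2 := fun v => by ring
  simp only [he]
  refine h.congr_fderiv ?_
  ext w
  simp
  ring

lemma heat_g2 {n : ℕ} (a : ℝ) (i : Fin n) (v : EuclideanSpace ℝ (Fin n)) :
    HasFDerivAt (fun v : EuclideanSpace ℝ (Fin n) => Real.exp (-‖v‖ ^ 2 / a) * (-2 / a) * v i)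
      ((Real.exp (-‖v‖ ^ 2 / a) * (-2 / a)) • (EuclideanSpace.proj i : _ →L[ℝ] ℝ)
        + (v i * (-2 / a)) • ((Real.exp (-‖v‖ ^ 2 / a) * (-2 / a)) • innerSL ℝ v)) v := by
  have h := ((heat_g1 a v).mul_const (-2 / a)).mul
    ((EuclideanSpace.proj i : EuclideanSpace ℝ (Fin n) →L[ℝ] ℝ).hasFDerivAt (x := v))
  refine h.congr_fderiv ?_
  ext w
  simp
  ring

lemma heat_time {n : ℕ} (f : EuclideanSpace ℝ (Fin n) → ℝ) (hf : Continuous f)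
    (M : ℝ) (hM : ∀ y, |f y| ≤ M) (x : EuclideanSpace ℝ (Fin n)) (D : ℝ) (hD : 0 < D)
    (t : ℝ) (ht : 0 < t) :
    HasDerivAt (fun τ : ℝ => ∫ y, f y * Real.exp (-‖x - y‖ ^ 2 / (4 * D * τ)))
      (∫ y, f y * (Real.exp (-‖x - y‖ ^ 2 / (4 * D * t)) * (‖x - y‖ ^ 2 / (4 * D * t ^ 2)))) t := by
  have hM0 : 0 ≤ M := (abs_nonneg _).trans (hM 0)
  have hgi : ∀ a : ℝ, 0 < a → Integrable (fun y => f y * Real.exp (-‖x - y‖ ^ 2 / a)) := by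
    intro a ha
    refine ((heat_gauss_int (1 / a) (by positivity) x).const_mul M).mono'
      (Continuous.aestronglyMeasurable (by fun_prop)) (Eventually.of_forall fun y => ?_)
    rw [norm_mul, Real.norm_eq_abs, Real.norm_eq_abs, Real.abs_exp]
    have : -‖x - y‖ ^ 2 / a = -(1 / a) * ‖x - y‖ ^ 2 := by ring
    rw [this]
    exact mul_le_mul_of_nonneg_right (hM y) (Real.exp_pos _).le
  refine (hasDerivAt_integral_of_dominated_loc_of_deriv_le
    (F := fun τ y => f y * Real.exp (-‖x - y‖ ^ 2 / (4 * D * τ)))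
    (F' := fun τ y => f y * (Real.exp (-‖x - y‖ ^ 2 / (4 * D * τ)) * (‖x - y‖ ^ 2 / (4 * D * τ ^ 2))))
    (bound := fun y => M * (1 / (4 * D * (t / 2) ^ 2) * (1 + 2 * (4 * D * (2 * t))))
      * Real.exp (-(1 / (2 * (4 * D * (2 * t)))) * ‖x - y‖ ^ 2))
    (Ioo_mem_nhds (show t / 2 < t by linarith) (show t < 2 * t by linarith))
    ?_ ?_ ?_ ?_ ?_ ?_).2
  · exact Eventually.of_forall fun w => Continuous.aestronglyMeasurable (by fun_prop)
  · exact hgi _ (by positivity)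
  · exact Continuous.aestronglyMeasurable (by fun_prop)
  · refine Eventually.of_forall fun y τ hτ => ?_
    have hτ0 : 0 < τ := by linarith [hτ.1]
    rw [norm_mul, Real.norm_eq_abs, mul_assoc M]
    refine mul_le_mul (hM y) ?_ (norm_nonneg _) hM0
    rw [Real.norm_of_nonneg (by positivity), mul_assoc (1 / (4 * D * (t / 2) ^ 2))]
    have hb := heat_bnd (4 * D * (2 * t)) (by positivity) (‖x - y‖ ^ 2) (by positivity)
    refine le_trans ?_ (mul_le_mul_of_nonneg_left hb (by positivity))
    have e1 : Real.exp (-‖x - y‖ ^ 2 / (4 * D * τ)) ≤ Real.exp (-‖x - y‖ ^ 2 / (4 * D * (2 * t))) := by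
      refine Real.exp_le_exp.2 ?_
      rw [neg_div, neg_div, neg_le_neg_iff]
      have := hτ.2.le
      gcongr
    have e2 : ‖x - y‖ ^ 2 / (4 * D * τ ^ 2) ≤ 1 / (4 * D * (t / 2) ^ 2) * (1 + ‖x - y‖ ^ 2) := by
      rw [div_mul_eq_mul_div, one_mul]
      have := hτ.1.le
      gcongr
      linarith
    calc _ ≤ _ := mul_le_mul e1 e2 (by positivity) (Real.exp_pos _).le
      _ = _ := by ring
  · exact (heat_gauss_int _ (by positivity) x).const_mul _
  · refine Eventually.of_forall fun y τ hτ => ?_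
    have hτ0 : 0 < τ := by linarith [hτ.1]
    have h := ((((hasDerivAt_id τ).const_mul (4 * D)).inv (by simp; constructor <;> positivity)).const_mul
      (-‖x - y‖ ^ 2)).exp.const_mul (f y)
    refine h.congr_deriv ?_
    simp only [id_eq, Pi.inv_apply, div_eq_mul_inv]
    congr 2
    field_simp

theorem stmt_5 (n : ℕ) (hn : 1 ≤ n) (D : ℝ) (hD : 0 < D)
    (f : EuclideanSpace ℝ (Fin n) → ℝ) (hf_cont : Continuous f)
    (hf_bdd : ∃ M : ℝ, ∀ y, |f y| ≤ M) :
    ∀ (x : EuclideanSpace ℝ (Fin n)) (t : ℝ), 0 < t →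
      HasDerivAt
        (fun τ : ℝ =>
          (4 * Real.pi * D * τ) ^ (-(n : ℝ) / 2) *
            ∫ y : EuclideanSpace ℝ (Fin n),
              f y * Real.exp (-‖x - y‖ ^ 2 / (4 * D * τ)))
        (D * ∑ i : Fin n,
          fderiv ℝ
            (fun z : EuclideanSpace ℝ (Fin n) =>
              fderiv ℝ
                (fun w : EuclideanSpace ℝ (Fin n) =>
                  (4 * Real.pi * D * t) ^ (-(n : ℝ) / 2) *
                    ∫ y : EuclideanSpace ℝ (Fin n),
                      f y * Real.exp (-‖w - y‖ ^ 2 / (4 * D * t)))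
                z (EuclideanSpace.single i 1))
            x (EuclideanSpace.single i 1))
        t := by
  intro x t ht
  obtain ⟨M, hM⟩ := hf_bdd
  have hM0 : 0 ≤ M := (abs_nonneg _).trans (hM 0)
  set a := 4 * D * t with ha_def
  have ha : 0 < a := by positivity
  set c := (4 * Real.pi * D * t) ^ (-(n : ℝ) / 2) with hc
  have hbn : ∀ v : EuclideanSpace ℝ (Fin n), (1 + ‖v‖ ^ 2) * Real.exp (-‖v‖ ^ 2 / a) ≤
      (1 + 2 * a) * Real.exp (-(1 / (2 * a)) * ‖v‖ ^ 2) :=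
    fun v => heat_bnd a ha (‖v‖ ^ 2) (by positivity)
  have hvi : ∀ (v : EuclideanSpace ℝ (Fin n)) i, |v i| ≤ ‖v‖ := fun v i => by
    simpa using PiLp.norm_apply_le v i
  have hb0 : 0 < 1 / (2 * a) := by positivity
  have hP : ∀ v : EuclideanSpace ℝ (Fin n), ∀ A : ℝ, A ≤ (1 + 2 / a) * (2 / a + 1) * (1 + ‖v‖ ^ 2) →
      A * Real.exp (-‖v‖ ^ 2 / a) ≤
      ((1 + 2 / a) * (2 / a + 1) * (1 + 2 * a)) * Real.exp (-(1 / (2 * a)) * ‖v‖ ^ 2) := by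
    intro v A hA
    have h1 := mul_le_mul_of_nonneg_left (hbn v)
      (show 0 ≤ (1 + 2 / a) * (2 / a + 1) by positivity)
    have h2 := mul_le_mul_of_nonneg_right hA (Real.exp_pos (-‖v‖ ^ 2 / a)).le
    calc _ ≤ _ := h2
      _ = _ := by ring
      _ ≤ _ := h1
      _ = _ := by ring
  have hq : 0 < 2 / a := by positivity
  have habs : |(-2 / a)| = 2 / a := by
    rw [neg_div, abs_neg, abs_of_pos hq]
  have hr1 : ∀ v : EuclideanSpace ℝ (Fin n), ‖v‖ ≤ 1 + ‖v‖ ^ 2 := fun v => by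
    nlinarith [sq_nonneg (‖v‖ - 1), norm_nonneg v]
  have hB1 : ∀ r : ℝ, 0 ≤ r → r ≤ 1 + r ^ 2 →
      2 / a * r ≤ (1 + 2 / a) * (2 / a + 1) * (1 + r ^ 2) := by
    intro r h0 h1
    have : 2 / a * r ≤ 2 / a * (1 + r ^ 2) := mul_le_mul_of_nonneg_left h1 hq.le
    have h3 : 2 / a ≤ (1 + 2 / a) * (2 / a + 1) := by nlinarith
    exact this.trans (mul_le_mul_of_nonneg_right h3 (by positivity))
  -- first derivatives
  have D1 := fun x => heat_fderiv f hf_cont M hM (fun v => Real.exp (-‖v‖ ^ 2 / a)) _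
    (fun v => heat_g1 a v) (by fun_prop) _ (1 / (2 * a)) hb0
    (fun v => by
      rw [Real.abs_exp]
      have := hP v 1 (by
        have h1 : 1 ≤ (1 + 2 / a) * (2 / a + 1) := by nlinarith
        nlinarith [sq_nonneg ‖v‖])
      simpa using this)
    (fun v => by
      rw [norm_smul, norm_mul, Real.norm_eq_abs, Real.norm_eq_abs, Real.abs_exp, habs,
        innerSL_apply_norm]
      have := hP v (2 / a * ‖v‖) (hB1 _ (norm_nonneg _) (hr1 v))
      calc _ = _ := by ring
        _ ≤ _ := this) x
  have D2 := fun i x => heat_fderiv f hf_cont M hM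
    (fun v => Real.exp (-‖v‖ ^ 2 / a) * (-2 / a) * v i) _
    (fun v => heat_g2 a i v) (by fun_prop) _ (1 / (2 * a)) hb0
    (fun v => by
      rw [abs_mul, abs_mul, Real.abs_exp, habs]
      have := hP v (2 / a * |v i|) ((mul_le_mul_of_nonneg_left (hvi v i) hq.le).trans
        (hB1 _ (norm_nonneg _) (hr1 v)))
      calc _ = _ := by ring
        _ ≤ _ := this)
    (fun v => by
      have hpr : ‖(EuclideanSpace.proj i : EuclideanSpace ℝ (Fin n) →L[ℝ] ℝ)‖ ≤ 1 :=
        ContinuousLinearMap.opNorm_le_bound _ zero_le_one fun w => by simpa using hvi w i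
      refine (norm_add_le _ _).trans ?_
      rw [norm_smul, norm_smul, norm_smul, norm_mul, norm_mul, innerSL_apply_norm]
      simp only [Real.norm_eq_abs, Real.abs_exp, habs]
      have hE := Real.exp_pos (-‖v‖ ^ 2 / a)
      refine le_trans ?_ (hP v (2 / a + (2 / a) ^ 2 * ‖v‖ ^ 2) ?_)
      · have t1 : Real.exp (-‖v‖ ^ 2 / a) * (2 / a) *
            ‖(EuclideanSpace.proj i : EuclideanSpace ℝ (Fin n) →L[ℝ] ℝ)‖ ≤
            Real.exp (-‖v‖ ^ 2 / a) * (2 / a) * 1 :=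
          mul_le_mul_of_nonneg_left hpr (by positivity)
        have t2 : |v i| * (2 / a) * (Real.exp (-‖v‖ ^ 2 / a) * (2 / a) * ‖v‖) ≤
            ‖v‖ * (2 / a) * (Real.exp (-‖v‖ ^ 2 / a) * (2 / a) * ‖v‖) := by
          have := hvi v i
          gcongr
        calc _ ≤ _ := add_le_add t1 t2
          _ = _ := by ring
      · have := sq_nonneg ‖v‖
        generalize 2 / a = q at *
        generalize ‖v‖ ^ 2 = s at *
        have h3 : 0 ≤ q * s := by positivity
        nlinarith [sq_nonneg q]) x
  have hfd : ∀ i : Fin n, (fun z : EuclideanSpace ℝ (Fin n) =>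
      fderiv ℝ (fun w : EuclideanSpace ℝ (Fin n) =>
        c * ∫ y : EuclideanSpace ℝ (Fin n), f y * Real.exp (-‖w - y‖ ^ 2 / a)) z
          (EuclideanSpace.single i 1)) =
      fun z => c * ∫ y, f y * (Real.exp (-‖z - y‖ ^ 2 / a) * (-2 / a) * (z - y) i) := by
    intro i
    funext z
    rw [((D1 z).2.const_mul c).fderiv, smul_apply,
      ContinuousLinearMap.integral_apply (D1 z).1, smul_eq_mul]
    congr 1
    refine integral_congr_ae (Eventually.of_forall fun y => ?_)
    simp [EuclideanSpace.inner_single_right]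
  have hsd : ∀ i : Fin n, fderiv ℝ (fun z : EuclideanSpace ℝ (Fin n) =>
      c * ∫ y, f y * (Real.exp (-‖z - y‖ ^ 2 / a) * (-2 / a) * (z - y) i)) x
        (EuclideanSpace.single i 1) =
      c * ∫ y, f y * (Real.exp (-‖x - y‖ ^ 2 / a) * (-2 / a + (4 / a ^ 2) * ((x - y) i) ^ 2)) := by
    intro i
    rw [((D2 i x).2.const_mul c).fderiv, smul_apply,
      ContinuousLinearMap.integral_apply (D2 i x).1, smul_eq_mul]
    congr 1
    refine integral_congr_ae (Eventually.of_forall fun y => ?_)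
    simp [EuclideanSpace.inner_single_right]
    ring
  have hint : ∀ i : Fin n, Integrable (fun y =>
      f y * (Real.exp (-‖x - y‖ ^ 2 / a) * (-2 / a + (4 / a ^ 2) * ((x - y) i) ^ 2))) := by
    intro i
    refine ((D2 i x).1.apply_continuousLinearMap (EuclideanSpace.single i 1)).congr
      (Eventually.of_forall fun y => ?_)
    simp [EuclideanSpace.inner_single_right]
    ring
  have hI0 : Integrable (fun y => f y * Real.exp (-‖x - y‖ ^ 2 / a)) := by
    refine ((heat_gauss_int (1 / a) (by positivity) x).const_mul M).mono'
      (Continuous.aestronglyMeasurable (by fun_prop)) (Eventually.of_forall fun y => ?_)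
    rw [norm_mul, Real.norm_eq_abs, Real.norm_eq_abs, Real.abs_exp]
    have : -‖x - y‖ ^ 2 / a = -(1 / a) * ‖x - y‖ ^ 2 := by ring
    rw [this]
    exact mul_le_mul_of_nonneg_right (hM y) (Real.exp_pos _).le
  have hT := heat_time f hf_cont M hM x D hD t ht
  have hpow : HasDerivAt (fun τ : ℝ => (4 * Real.pi * D * τ) ^ (-(n : ℝ) / 2))
      (c * (-(n : ℝ) / 2 / t)) t := by
    have hpos : 0 < 4 * Real.pi * D * t := by positivity
    have h := ((hasDerivAt_id t).const_mul (4 * Real.pi * D)).rpow_const (p := -(n : ℝ) / 2)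
      (Or.inl (by simpa using hpos.ne'))
    refine h.congr_deriv ?_
    simp only [id_eq]
    rw [Real.rpow_sub_one hpos.ne', hc]
    field_simp
  refine (hpow.mul hT).congr_deriv ?_
  simp only [hfd, hsd]
  rw [← Finset.mul_sum, ← integral_finsetSum _ (fun i _ => hint i), ← ha_def]
  have hkey : ∀ y, ∑ i : Fin n,
      f y * (Real.exp (-‖x - y‖ ^ 2 / a) * (-2 / a + (4 / a ^ 2) * ((x - y) i) ^ 2)) =
      (-(n : ℝ) / 2 / t / D) * (f y * Real.exp (-‖x - y‖ ^ 2 / a)) +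
      (1 / D) * (f y * (Real.exp (-‖x - y‖ ^ 2 / a) * (‖x - y‖ ^ 2 / (4 * D * t ^ 2)))) := by
    intro y
    rw [← Finset.mul_sum, ← Finset.mul_sum, Finset.sum_add_distrib, ← Finset.mul_sum]
    have : ∑ i : Fin n, ((x - y) i) ^ 2 = ‖x - y‖ ^ 2 := by
      rw [EuclideanSpace.norm_sq_eq]; simp
    rw [this]
    generalize Real.exp (-‖x - y‖ ^ 2 / a) = E
    simp only [Finset.sum_const, Finset.card_univ, Fintype.card_fin, nsmul_eq_mul]
    rw [ha_def]
    field_simp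
    ring
  have hI2 : Integrable (fun y =>
      f y * (Real.exp (-‖x - y‖ ^ 2 / a) * (‖x - y‖ ^ 2 / (4 * D * t ^ 2)))) := by
    have h := ((integrable_finsetSum Finset.univ (fun i _ => hint i)).sub
      (hI0.const_mul (-(n : ℝ) / 2 / t / D))).const_mul D
    refine h.congr (Eventually.of_forall fun y => ?_)
    simp only [Pi.sub_apply, hkey]
    field_simp
    ring
  simp only [hkey]
  rw [integral_add (hI0.const_mul _) (hI2.const_mul _), integral_const_mul, integral_const_mul]
  simp only [hc, ha_def]
  field_simp
end

section
/- Let κ_f > 0, Δt > 0, and A₀, B₀ > 0 with A₀ ≠ B₀. Define c₁ = A₀ − B₀, c₃ = A₀ + B₀, c₅ = B₀/A₀, and for each κ_b > 0 set c₂(κ_b) = √(κ_f²c₁² + 4κ_f κ_b), c₄(κ_b) = (c₂(κ_b) − κ_f c₃)/(c₂(κ_b) + κ_f c₃), and F(κ_b) = (c₂(κ_b) + κ_f c₁ − (c₂(κ_b) − κ_f c₁)·c₄(κ_b)·e^{−c₂(κ_b)·Δt}) / (2κ_f·(1 + c₄(κ_b)·e^{−c₂(κ_b)·Δt})). Then F(κ_b)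 tends to c₁/(1 − c₅·e^{−κ_f c₁ Δt}) as κ_b tends to 0 from the right. -/
theorem aux_lim (κf Δt c s x0 : ℝ) (c2 : ℝ → ℝ) (l : Filter ℝ)
    (h : Filter.Tendsto c2 l (nhds x0)) (h1 : x0 + κf * s ≠ 0)
    (h2 : 2 * κf * (1 + (x0 - κf * s) / (x0 + κf * s) * Real.exp (-x0 * Δt)) ≠ 0) :
    Filter.Tendsto (fun k => (c2 k + κf * c - (c2 k - κf * c) * ((c2 k - κf * s) / (c2 k + κf * s)) * Real.exp (-c2 k * Δt)) /
          (2 * κf * (1 + (c2 k - κf * s) / (c2 k + κf * s) * Real.exp (-c2 k * Δt)))) l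
      (nhds ((x0 + κf * c - (x0 - κf * c) * ((x0 - κf * s) / (x0 + κf * s)) * Real.exp (-x0 * Δt)) /
          (2 * κf * (1 + (x0 - κf * s) / (x0 + κf * s) * Real.exp (-x0 * Δt))))) := by
  have h4 := (h.sub_const (κf * s)).div (h.add_const (κf * s)) h1
  have he : Filter.Tendsto (fun k => Real.exp (-c2 k * Δt)) l (nhds (Real.exp (-x0 * Δt))) :=
    (Real.continuous_exp.tendsto _).comp (h.neg.mul_const Δt)
  exact ((h.add_const _).sub (((h.sub_const _).mul h4).mul he)).div
    (((h4.mul he).const_add 1).const_mul (2 * κf)) h2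

theorem stmt_10 (κf Δt A₀ B₀ : ℝ) (hκf : 0 < κf) (hΔt : 0 < Δt)
    (hA : 0 < A₀) (hB : 0 < B₀) (hne : A₀ ≠ B₀) :
    Filter.Tendsto
      (fun κb : ℝ =>
        let c₁ := A₀ - B₀
        let c₂ := Real.sqrt (κf ^ 2 * c₁ ^ 2 + 4 * κf * κb)
        let c₄ := (c₂ - κf * (A₀ + B₀)) / (c₂ + κf * (A₀ + B₀))
        (c₂ + κf * c₁ - (c₂ - κf * c₁) * c₄ * Real.exp (-c₂ * Δt)) /
          (2 * κf * (1 + c₄ * Real.exp (-c₂ * Δt))))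
      (nhdsWithin 0 (Set.Ioi 0))
      (nhds ((A₀ - B₀) /
        (1 - B₀ / A₀ * Real.exp (-κf * (A₀ - B₀) * Δt)))) := by
  have hc : Filter.Tendsto (fun κb : ℝ => Real.sqrt (κf ^ 2 * (A₀ - B₀) ^ 2 + 4 * κf * κb))
      (nhdsWithin 0 (Set.Ioi 0)) (nhds (κf * |A₀ - B₀|)) := by
    have hcont : Continuous (fun κb : ℝ => Real.sqrt (κf ^ 2 * (A₀ - B₀) ^ 2 + 4 * κf * κb)) := by
      fun_prop
    have h0 := (hcont.tendsto 0).mono_left (nhdsWithin_le_nhds (s := Set.Ioi 0))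
    have e : Real.sqrt (κf ^ 2 * (A₀ - B₀) ^ 2 + 4 * κf * 0) = κf * |A₀ - B₀| := by
      rw [mul_zero, add_zero, ← mul_pow, Real.sqrt_sq_eq_abs, abs_mul, abs_of_pos hκf]
    rwa [e] at h0
  rcases lt_or_gt_of_ne hne with hlt | hlt
  · rw [abs_of_neg (by linarith)] at hc
    have e4 : (κf * -(A₀ - B₀) - κf * (A₀ + B₀)) / (κf * -(A₀ - B₀) + κf * (A₀ + B₀)) = -(A₀ / B₀) := by
      have : κf * -(A₀ - B₀) + κf * (A₀ + B₀) = 2 * κf * B₀ := by ring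
      rw [this]; field_simp; ring
    have hE : Real.exp (-(κf * -(A₀ - B₀)) * Δt) < 1 := by
      rw [Real.exp_lt_one_iff]
      have : 0 < κf * (B₀ - A₀) * Δt := mul_pos (mul_pos hκf (by linarith)) hΔt
      linarith
    have hr : A₀ / B₀ < 1 := (div_lt_one hB).2 hlt
    have hr0 : 0 < A₀ / B₀ := div_pos hA hB
    have hE0 := Real.exp_pos (-(κf * -(A₀ - B₀)) * Δt)
    have hd : 0 < 1 + -(A₀ / B₀) * Real.exp (-(κf * -(A₀ - B₀)) * Δt) := by nlinarith
    have key := aux_lim κf Δt (A₀ - B₀) (A₀ + B₀) _ _ _ hc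
      (by have : 0 < κf * B₀ := mul_pos hκf hB
          nlinarith) (by rw [e4]; positivity)
    rw [e4] at key
    convert key using 2
    have e5 : Real.exp (-κf * (A₀ - B₀) * Δt) = (Real.exp (-(κf * -(A₀ - B₀)) * Δt))⁻¹ := by
      rw [← Real.exp_neg]; congr 1; ring
    rw [e5]
    generalize Real.exp (-(κf * -(A₀ - B₀)) * Δt) = E at *
    have hAE : A₀ * E < B₀ := by nlinarith
    have n1 : 1 - B₀ / A₀ * E⁻¹ ≠ 0 := by
      have : 1 - B₀ / A₀ * E⁻¹ = (A₀ * E - B₀) / (A₀ * E) := by field_simp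
      rw [this]
      exact div_ne_zero (by linarith) (by positivity)
    rw [div_eq_div_iff n1 (by positivity)]
    field_simp
    ring
  · rw [abs_of_pos (by linarith)] at hc
    have e4 : (κf * (A₀ - B₀) - κf * (A₀ + B₀)) / (κf * (A₀ - B₀) + κf * (A₀ + B₀)) = -(B₀ / A₀) := by
      have : κf * (A₀ - B₀) + κf * (A₀ + B₀) = 2 * κf * A₀ := by ring
      rw [this]; field_simp; ring
    have hE : Real.exp (-(κf * (A₀ - B₀)) * Δt) < 1 := by
      rw [Real.exp_lt_one_iff]
      have : 0 < κf * (A₀ - B₀) * Δt := mul_pos (mul_pos hκf (by linarith)) hΔt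
      linarith
    have hr : B₀ / A₀ < 1 := (div_lt_one hA).2 hlt
    have hr0 : 0 < B₀ / A₀ := div_pos hB hA
    have hE0 := Real.exp_pos (-(κf * (A₀ - B₀)) * Δt)
    have hd : 0 < 1 + -(B₀ / A₀) * Real.exp (-(κf * (A₀ - B₀)) * Δt) := by nlinarith
    have key := aux_lim κf Δt (A₀ - B₀) (A₀ + B₀) _ _ _ hc
      (by have : 0 < κf * A₀ := mul_pos hκf hA
          nlinarith) (by rw [e4]; positivity)
    rw [e4] at key
    convert key using 2
    rw [neg_mul κf]
    generalize Real.exp (-(κf * (A₀ - B₀)) * Δt) = E at *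
    generalize B₀ / A₀ = r at *
    rw [div_eq_div_iff (by linarith) (by positivity)]
    ring
end

section
/- Let κ_f > 0, Δt > 0, and A₀ > 0, and set B₀ = A₀ (so c₁ = A₀ − B₀ = 0 and c₃ = 2A₀). For each κ_b > 0 set c₂(κ_b) = √(4κ_f κ_b), c₄(κ_b) = (c₂(κ_b) − κ_f c₃)/(c₂(κ_b) + κ_f c₃), and F(κ_b) = (c₂(κ_b) − c₂(κ_b)·c₄(κ_b)·e^{−c₂(κ_b)·Δt}) / (2κ_f·(1 + c₄(κ_b)·e^{−c₂(κ_b)·Δt})). Then F(κ_b) tends to 1/(κ_f·Δt + 1/A₀) as κ_b tends to 0 from the right. -/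
theorem aux_11 (κf Δt A₀ : ℝ) (hκf : 0 < κf) (hΔt : 0 < Δt) (hA : 0 < A₀) :
    Filter.Tendsto
      (fun x : ℝ =>
        (x - x * ((x - κf * (2 * A₀)) / (x + κf * (2 * A₀))) * Real.exp (-x * Δt)) /
          (2 * κf * (1 + ((x - κf * (2 * A₀)) / (x + κf * (2 * A₀))) * Real.exp (-x * Δt))))
      (nhdsWithin 0 (Set.Ioi 0))
      (nhds (1 / (κf * Δt + 1 / A₀))) := by
  have hd : HasDerivAt (fun x : ℝ => Real.exp (-x * Δt)) (-Δt) 0 := by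
    have h := (((hasDerivAt_id (0 : ℝ)).neg).mul_const Δt).exp
    simpa using h
  have hs := hd.tendsto_slope_zero_right
  simp only [zero_add, neg_zero, zero_mul, Real.exp_zero, smul_eq_mul] at hs
  have hx : Filter.Tendsto (fun x : ℝ => x) (nhdsWithin 0 (Set.Ioi 0)) (nhds 0) :=
    Filter.tendsto_id.mono_left nhdsWithin_le_nhds
  have hE : Filter.Tendsto (fun x : ℝ => Real.exp (-x * Δt))
      (nhdsWithin 0 (Set.Ioi 0)) (nhds 1) := by
    have h := hd.continuousAt.tendsto.mono_left
      (nhdsWithin_le_nhds (s := Set.Ioi (0 : ℝ)))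
    simpa using h
  have hm : 0 < κf * (2 * A₀) := by positivity
  have hN := (hx.add_const (κf * (2 * A₀))).sub ((hx.sub_const (κf * (2 * A₀))).mul hE)
  have hD := ((hE.const_add 1).sub (hs.const_mul (κf * (2 * A₀)))).const_mul (2 * κf)
  have hD0 : 2 * κf * (1 + 1 - κf * (2 * A₀) * -Δt) ≠ 0 := by
    have : 0 < 2 * κf * (1 + 1 + κf * (2 * A₀) * Δt) := by positivity
    intro h
    linarith
  have hlim := hN.div hD hD0
  have hval : 1 / (κf * Δt + 1 / A₀) =
      (0 + κf * (2 * A₀) - (0 - κf * (2 * A₀)) * 1) /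
        (2 * κf * (1 + 1 - κf * (2 * A₀) * -Δt)) := by
    have h1 : κf * Δt + 1 / A₀ ≠ 0 := by positivity
    rw [div_eq_div_iff h1 hD0]
    field_simp
    ring
  rw [hval]
  refine hlim.congr' ?_
  filter_upwards [self_mem_nhdsWithin] with x hx0
  have hx0 : 0 < x := hx0
  simp only [Pi.div_apply]
  have hE1 : Real.exp (-x * Δt) < 1 := by
    rw [Real.exp_lt_one_iff]
    nlinarith [mul_pos hx0 hΔt]
  have hE0 := Real.exp_pos (-x * Δt)
  generalize Real.exp (-x * Δt) = E at *
  generalize κf * (2 * A₀) = m at *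
  have hxm : x + m ≠ 0 := by positivity
  have hP : 0 < x * (1 + E) + m * (1 - E) := by
    have := mul_pos hm (sub_pos.2 hE1)
    positivity
  have e1 : 2 * κf * (1 + E - m * (x⁻¹ * (E - 1))) =
      2 * κf * (x * (1 + E) + m * (1 - E)) / x := by
    field_simp
    ring
  have e2 : 2 * κf * (1 + (x - m) / (x + m) * E) =
      2 * κf * (x * (1 + E) + m * (1 - E)) / (x + m) := by
    field_simp
    ring
  have e3 : x - x * ((x - m) / (x + m)) * E = x * (x + m - (x - m) * E) / (x + m) := by
    field_simp
  rw [e1, e2, e3]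
  generalize x * (1 + E) + m * (1 - E) = P at *
  have := hP.ne'
  field_simp

theorem stmt_11 (κf Δt A₀ : ℝ) (hκf : 0 < κf) (hΔt : 0 < Δt) (hA : 0 < A₀) :
    Filter.Tendsto
      (fun κb : ℝ =>
        let c₂ := Real.sqrt (4 * κf * κb)
        let c₄ := (c₂ - κf * (2 * A₀)) / (c₂ + κf * (2 * A₀))
        (c₂ - c₂ * c₄ * Real.exp (-c₂ * Δt)) /
          (2 * κf * (1 + c₄ * Real.exp (-c₂ * Δt))))
      (nhdsWithin 0 (Set.Ioi 0))
      (nhds (1 / (κf * Δt + 1 / A₀))) := by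
  have hc : Filter.Tendsto (fun κb : ℝ => Real.sqrt (4 * κf * κb))
      (nhdsWithin 0 (Set.Ioi 0)) (nhdsWithin 0 (Set.Ioi 0)) := by
    refine tendsto_nhdsWithin_iff.2 ⟨?_, ?_⟩
    · have h : Continuous (fun κb : ℝ => Real.sqrt (4 * κf * κb)) := by fun_prop
      have h2 := (h.tendsto 0).mono_left (nhdsWithin_le_nhds (s := Set.Ioi (0 : ℝ)))
      simpa using h2
    · filter_upwards [self_mem_nhdsWithin] with x hx0
      have hx0 : 0 < x := hx0
      exact Real.sqrt_pos.2 (by positivity)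
  exact (aux_11 κf Δt A₀ hκf hΔt hA).comp hc
end

section
/- Let κ_f > 0, κ_b > 0 and A₀, B₀ > 0. Define c₁ = A₀ − B₀, c₂ = √(κ_f²c₁² + 4κ_f κ_b), c₃ = A₀ + B₀, c₄ = (c₂ − κ_f c₃)/(c₂ + κ_f c₃), and for t ≥ 0 set C_A(t) = (c₂ + κ_f c₁ − (c₂ − κ_f c₁)·c₄·e^{−c₂ t}) / (2κ_f·(1 + c₄·e^{−c₂ t})) and C_B(t) = (c₂ − κ_f c₁ − (c₂ + κ_f c₁)·c₄·e^{−c₂ t}) / (2κ_f·(1 + c₄·e^{−c₂ t})). Then for every t ≥ 0: |c₄| < 1, 1 + c₄·e^{−c₂ t} > 0, C_A(t) > 0, and C_B(t) > 0. -/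
theorem stmt_15 (κf κb A₀ B₀ : ℝ) (hκf : 0 < κf) (hκb : 0 < κb)
    (hA : 0 < A₀) (hB : 0 < B₀) :
    let c₁ := A₀ - B₀
    let c₂ := Real.sqrt (κf ^ 2 * c₁ ^ 2 + 4 * κf * κb)
    let c₃ := A₀ + B₀
    let c₄ := (c₂ - κf * c₃) / (c₂ + κf * c₃)
    let CA : ℝ → ℝ := fun t =>
      (c₂ + κf * c₁ - (c₂ - κf * c₁) * c₄ * Real.exp (-c₂ * t)) /
        (2 * κf * (1 + c₄ * Real.exp (-c₂ * t)))
    let CB : ℝ → ℝ := fun t =>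
      (c₂ - κf * c₁ - (c₂ + κf * c₁) * c₄ * Real.exp (-c₂ * t)) /
        (2 * κf * (1 + c₄ * Real.exp (-c₂ * t)))
    |c₄| < 1 ∧
      ∀ t : ℝ, 0 ≤ t →
        0 < 1 + c₄ * Real.exp (-c₂ * t) ∧ 0 < CA t ∧ 0 < CB t := by
  intro c₁ c₂ c₃ c₄ CA CB
  have hkk : 0 < κf * κb := mul_pos hκf hκb
  have hsq : c₂ ^ 2 = κf ^ 2 * c₁ ^ 2 + 4 * κf * κb := Real.sq_sqrt (by positivity)
  have hc₂ : 0 < c₂ := Real.sqrt_pos.mpr (by positivity)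
  have habs : |κf * c₁| < c₂ := by
    apply abs_lt_of_sq_lt_sq _ hc₂.le
    rw [hsq]; nlinarith
  obtain ⟨h1, h2⟩ := abs_lt.mp habs
  have hc₃ : 0 < κf * c₃ := mul_pos hκf (add_pos hA hB)
  have hs : 0 < c₂ + κf * c₃ := by linarith
  have h4 : |c₄| < 1 := by
    rw [abs_lt]
    constructor
    · rw [lt_div_iff₀ hs]; linarith
    · rw [div_lt_one hs]; linarith
  refine ⟨h4, fun t ht => ?_⟩
  obtain ⟨h5, h6⟩ := abs_lt.mp h4
  have hE0 : 0 < Real.exp (-c₂ * t) := Real.exp_pos _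
  have hE1 : Real.exp (-c₂ * t) ≤ 1 := by
    rw [Real.exp_le_one_iff]; nlinarith
  have hNA : 0 < (c₂ + κf * c₁) - (c₂ - κf * c₁) * c₄ := by
    have : (c₂ + κf * c₁) - (c₂ - κf * c₁) * c₄ = 4 * c₂ * κf * A₀ / (c₂ + κf * c₃) := by
      rw [eq_div_iff hs.ne']
      have h : c₄ * (c₂ + κf * c₃) = c₂ - κf * c₃ := div_mul_cancel₀ _ hs.ne'
      have e : c₁ + c₃ = 2 * A₀ := by simp only [c₁, c₃]; ring
      linear_combination (-(c₂ - κf * c₁)) * h + 2 * c₂ * κf * e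
    rw [this]; positivity
  have hNB : 0 < (c₂ - κf * c₁) - (c₂ + κf * c₁) * c₄ := by
    have : (c₂ - κf * c₁) - (c₂ + κf * c₁) * c₄ = 4 * c₂ * κf * B₀ / (c₂ + κf * c₃) := by
      rw [eq_div_iff hs.ne']
      have h : c₄ * (c₂ + κf * c₃) = c₂ - κf * c₃ := div_mul_cancel₀ _ hs.ne'
      have e : c₃ - c₁ = 2 * B₀ := by simp only [c₁, c₃]; ring
      linear_combination (-(c₂ + κf * c₁)) * h + 2 * c₂ * κf * e
    rw [this]; positivity
  have key : ∀ p q E : ℝ, 0 < p → 0 < p - q → 0 < E → E ≤ 1 → 0 < p - q * E := by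
    intro p q E hp hq h0 hl
    nlinarith [mul_pos hq h0, mul_nonneg hp.le (sub_nonneg.mpr hl)]
  have hD : 0 < 1 + c₄ * Real.exp (-c₂ * t) := by
    have := key 1 (-c₄) _ one_pos (by linarith) hE0 hE1
    linarith
  refine ⟨hD, ?_, ?_⟩
  · exact div_pos (key _ _ _ (by linarith) hNA hE0 hE1) (mul_pos (by linarith) hD)
  · exact div_pos (key _ _ _ (by linarith) hNB hE0 hE1) (mul_pos (by linarith) hD)
end

section
/- Let κ_f > 0, κ_b > 0 and A₀, B₀ > 0. Define c₁ = A₀ − B₀, c₂ = √(κ_f²c₁² + 4κ_f κ_b), c₃ = A₀ + B₀, c₄ = (c₂ − κ_f c₃)/(c₂ + κ_f c₃), and for t ≥ 0 set C_A(t) = (c₂ + κ_f c₁ − (c₂ − κ_f c₁)·c₄·e^{−c₂ t}) / (2κ_f·(1 + c₄·e^{−c₂ t})). Then (C_A(Δt) − A₀)/Δt tends to κ_b − κ_f·A₀·B₀ as Δt tends to 0 from the right. -/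
theorem stmt_16 (κf κb A₀ B₀ : ℝ) (hκf : 0 < κf) (hκb : 0 < κb)
    (hA : 0 < A₀) (hB : 0 < B₀) :
    let c₁ := A₀ - B₀
    let c₂ := Real.sqrt (κf ^ 2 * c₁ ^ 2 + 4 * κf * κb)
    let c₃ := A₀ + B₀
    let c₄ := (c₂ - κf * c₃) / (c₂ + κf * c₃)
    let CA : ℝ → ℝ := fun t =>
      (c₂ + κf * c₁ - (c₂ - κf * c₁) * c₄ * Real.exp (-c₂ * t)) /
        (2 * κf * (1 + c₄ * Real.exp (-c₂ * t)))
    Filter.Tendsto (fun Δt : ℝ => (CA Δt - A₀) / Δt)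
      (nhdsWithin 0 (Set.Ioi 0)) (nhds (κb - κf * A₀ * B₀)) := by
  intro c₁ c₂ c₃ c₄ CA
  have hpos : 0 < κf ^ 2 * c₁ ^ 2 + 4 * κf * κb := by positivity
  have h2 : 0 < c₂ := Real.sqrt_pos.mpr hpos
  have hsq : c₂ ^ 2 = κf ^ 2 * (A₀ - B₀) ^ 2 + 4 * κf * κb := Real.sq_sqrt hpos.le
  have h3 : c₃ = A₀ + B₀ := rfl
  have h1 : c₁ = A₀ - B₀ := rfl
  have h3p : 0 < c₃ := by positivity
  have hS : 0 < c₂ + κf * c₃ := by positivity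
  have h4 : c₄ * (c₂ + κf * c₃) = c₂ - κf * c₃ := div_mul_cancel₀ _ hS.ne'
  have hD : 0 < 1 + c₄ := by
    have : (1 + c₄) * (c₂ + κf * c₃) = 2 * c₂ := by linear_combination h4
    by_contra hn
    nlinarith
  have hCA : ∀ t, CA t = (c₂ + κf * c₁ - (c₂ - κf * c₁) * c₄ * Real.exp (-c₂ * t)) /
        (2 * κf * (1 + c₄ * Real.exp (-c₂ * t))) := fun t => rfl
  have h0 : CA 0 = A₀ := by
    rw [hCA, mul_zero, Real.exp_zero, mul_one, mul_one, div_eq_iff (by positivity), h1]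
    rw [h3] at h4
    linear_combination -h4
  have he : HasDerivAt (fun t : ℝ => Real.exp (-c₂ * t)) (-c₂) 0 := by
    have := ((hasDerivAt_id (0 : ℝ)).const_mul (-c₂)).exp
    simpa using this
  have hN := (he.const_mul ((c₂ - κf * c₁) * c₄)).const_sub (c₂ + κf * c₁)
  have hDn := ((he.const_mul c₄).const_add 1).const_mul (2 * κf)
  have hne : 2 * κf * (1 + c₄ * Real.exp (-c₂ * 0)) ≠ 0 := by
    rw [mul_zero, Real.exp_zero, mul_one]; positivity
  have hd := hN.div hDn hne
  have hder : HasDerivAt CA (κb - κf * A₀ * B₀) 0 := by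
    refine HasDerivAt.congr_deriv (f := CA) hd ?_
    simp only [mul_zero, Real.exp_zero, mul_one]
    rw [div_eq_iff (by positivity)]
    have hc4 : c₄ = (c₂ - κf * c₃) / (c₂ + κf * c₃) := rfl
    have hkb : κb = (c₂ ^ 2 - κf ^ 2 * (A₀ - B₀) ^ 2) / (4 * κf) := by
      rw [eq_div_iff (by positivity)]; linear_combination -hsq
    clear_value c₄ c₂ c₃ c₁
    rw [hkb, hc4, h1]
    rw [h3] at hS ⊢
    have := hS.ne'
    field_simp
    ring
  have := (hasDerivAt_iff_tendsto_slope_zero.mp hder).mono_left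
    (nhdsWithin_mono (s := Set.Ioi 0) 0 (fun x (hx : 0 < x) => hx.ne'))
  simpa [h0, div_eq_inv_mul] using this
end
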